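/- Let α, β, γ > 0 be real and t > 0. Then the recurrence α² γ(γ+1) t² E_{α, 2α+β+2}^{γ+2}(t) = E_{α,β}^γ(t) − (α + 2β + 1) E_{α,β+1}^γ(t) + (α+β+1)(β+1) E_{α,β+2}^γ(t) holds. -/

import Mathlib

open scoped BigOperators

/-- Pochhammer symbol `(γ)_k = Γ(γ+k)/Γ(γ)`. -/
noncomputable def poch (γ : ℝ) (k : ℕ) : ℝ := Real.Gamma (γ + k) / Real.Gamma γ

/-- The Prabhakar (three-parameter Mittag-Leffler) function
`E_{α,β}^γ(x) = ∑_{k≥0} (γ)_k x^k / (k! Γ(αk+β))`. -/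
noncomputable def prabhakar (α β γ x : ℝ) : ℝ :=
  ∑' k : ℕ, poch γ k * x ^ k / (k.factorial * Real.Gamma (α * k + β))

/-- The `k`-th term of the Prabhakar series. -/
noncomputable def prabhakarTerm (α β γ x : ℝ) (k : ℕ) : ℝ :=
  poch γ k * x ^ k / (k.factorial * Real.Gamma (α * k + β))

theorem exp_neg_mul_rpow_le_Gamma {R s : ℝ} (hR : 0 < R) (hs : 1 ≤ s) :
    Real.exp (-R) * R ^ (s - 1) ≤ Real.Gamma s := by
  have hs0 : 0 < s := by linarith
  have hconv := Real.GammaIntegral_convergent hs0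
  have hsub : Set.Ioi R ⊆ Set.Ioi (0 : ℝ) := Set.Ioi_subset_Ioi hR.le
  rw [Real.Gamma_eq_integral hs0]
  calc Real.exp (-R) * R ^ (s - 1)
      = ∫ x in Set.Ioi R, Real.exp (-x) * R ^ (s - 1) := by
        rw [MeasureTheory.integral_mul_const, integral_exp_neg_Ioi]
    _ ≤ ∫ x in Set.Ioi R, Real.exp (-x) * x ^ (s - 1) := by
        refine MeasureTheory.setIntegral_mono_on ?_ (hconv.mono_set hsub) measurableSet_Ioi ?_
        · exact (integrableOn_exp_neg_Ioi R).mul_const _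
        · intro x hx
          have hx' : R < x := hx
          have : R ^ (s - 1) ≤ x ^ (s - 1) :=
            Real.rpow_le_rpow hR.le hx'.le (by linarith)
          gcongr
    _ ≤ ∫ x in Set.Ioi (0 : ℝ), Real.exp (-x) * x ^ (s - 1) := by
        refine MeasureTheory.setIntegral_mono_set hconv ?_ hsub.eventuallyLE
        filter_upwards [MeasureTheory.ae_restrict_mem measurableSet_Ioi] with x hx
        have hx' : 0 < x := hx
        positivity

theorem poch_succ {γ : ℝ} (hγ : 0 < γ) (k : ℕ) : poch γ (k + 1) = (γ + k) * poch γ k := by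
  have h : γ + ((k + 1 : ℕ) : ℝ) = (γ + k) + 1 := by push_cast; ring
  rw [poch, poch, h, Real.Gamma_add_one (by positivity), mul_div_assoc]

theorem poch_pos {γ : ℝ} (hγ : 0 < γ) (k : ℕ) : 0 < poch γ k :=
  div_pos (Real.Gamma_pos_of_pos (by positivity)) (Real.Gamma_pos_of_pos hγ)

theorem poch_le_factorial_mul_pow {γ : ℝ} (hγ : 0 < γ) (k : ℕ) :
    poch γ k ≤ k.factorial * (γ + 1) ^ k := by
  induction k with
  | zero => simp [poch, (Real.Gamma_pos_of_pos hγ).ne']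
  | succ k ih =>
    have h : γ + k ≤ (k + 1) * (γ + 1) := by
      have : 0 ≤ (k : ℝ) * γ := by positivity
      linarith
    calc poch γ (k + 1) = (γ + k) * poch γ k := poch_succ hγ k
      _ ≤ ((k + 1) * (γ + 1)) * (k.factorial * (γ + 1) ^ k) := by
        have := (poch_pos hγ k).le
        gcongr
      _ = (k + 1).factorial * (γ + 1) ^ (k + 1) := by
        rw [Nat.factorial_succ]; push_cast; ring

theorem summable_prabhakarTerm {α β γ t : ℝ} (hα : 0 < α) (hβ : 0 < β) (hγ : 0 < γ)
    (ht : 0 < t) : Summable (prabhakarTerm α β γ t) := by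
  obtain ⟨R, hR, hRα⟩ : ∃ R : ℝ, 0 < R ∧ R ^ α = 2 * ((γ + 1) * t) :=
    ⟨(2 * ((γ + 1) * t)) ^ α⁻¹, by positivity, Real.rpow_inv_rpow (by positivity) hα.ne'⟩
  refine summable_of_isBigO_nat
    (g := fun k : ℕ => (Real.exp (-R) * R ^ (β - 1))⁻¹ * (1 / 2 : ℝ) ^ k)
    (summable_geometric_two.mul_left _) ?_
  refine Asymptotics.IsBigO.of_bound 1 ?_
  obtain ⟨N, hN⟩ := exists_nat_ge α⁻¹
  filter_upwards [Filter.eventually_ge_atTop N] with k hk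
  have hk' : α⁻¹ ≤ k := hN.trans (by exact_mod_cast hk)
  have hs : 1 ≤ α * k + β := by
    have : α * α⁻¹ ≤ α * k := by gcongr
    rw [mul_inv_cancel₀ hα.ne'] at this
    linarith
  have hΓ : Real.exp (-R) * R ^ (β - 1) * (2 * ((γ + 1) * t)) ^ k
      ≤ Real.Gamma (α * k + β) := by
    refine le_trans (le_of_eq ?_) (exp_neg_mul_rpow_le_Gamma hR hs)
    rw [← hRα, ← Real.rpow_natCast, ← Real.rpow_mul hR.le, mul_assoc, ← Real.rpow_add hR]
    congr 2
    ring
  have hp := poch_pos hγ k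
  have hg : 0 < Real.Gamma (α * k + β) := Real.Gamma_pos_of_pos (by linarith)
  have hfac : (0 : ℝ) < k.factorial := by exact_mod_cast k.factorial_pos
  have hC : 0 < Real.exp (-R) * R ^ (β - 1) := by positivity
  rw [prabhakarTerm, Real.norm_of_nonneg (by positivity), Real.norm_of_nonneg (by positivity),
    one_mul]
  calc poch γ k * t ^ k / (k.factorial * Real.Gamma (α * k + β))
      ≤ (k.factorial * (γ + 1) ^ k) * t ^ k /
          (k.factorial * (Real.exp (-R) * R ^ (β - 1) * (2 * ((γ + 1) * t)) ^ k)) := by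
        gcongr
        exact poch_le_factorial_mul_pow hγ k
    _ = (Real.exp (-R) * R ^ (β - 1))⁻¹ * (1 / 2 : ℝ) ^ k := by
        simp only [mul_pow, div_pow, one_pow]
        field_simp

theorem prabhakarTerm_combination {α β γ : ℝ} (t : ℝ) (hα : 0 < α) (hβ : 0 < β) (k : ℕ) :
    prabhakarTerm α β γ t k - (α + 2 * β + 1) * prabhakarTerm α (β + 1) γ t k
        + (α + β + 1) * (β + 1) * prabhakarTerm α (β + 2) γ t k
      = α ^ 2 * (k * (k - 1)) * prabhakarTerm α (β + 2) γ t k := by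
  have hz : 0 < α * k + β := by positivity
  have h1 : Real.Gamma (α * k + (β + 1)) = (α * k + β) * Real.Gamma (α * k + β) := by
    rw [← add_assoc, Real.Gamma_add_one hz.ne']
  have h2 : Real.Gamma (α * k + (β + 2))
      = (α * k + β + 1) * ((α * k + β) * Real.Gamma (α * k + β)) := by
    rw [show α * k + (β + 2) = (α * k + β + 1) + 1 by ring,
      Real.Gamma_add_one (by positivity), Real.Gamma_add_one hz.ne']
  have hg : Real.Gamma (α * k + β) ≠ 0 := (Real.Gamma_pos_of_pos hz).ne'
  have hfac : (k.factorial : ℝ) ≠ 0 := by exact_mod_cast k.factorial_ne_zero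
  simp only [prabhakarTerm, h1, h2]
  have hz1 : α * k + β + 1 ≠ 0 := by positivity
  have hz0 := hz.ne'
  field_simp
  ring

theorem poch_add_two {γ : ℝ} (hγ : 0 < γ) (k : ℕ) :
    poch γ (k + 2) = γ * (γ + 1) * poch (γ + 2) k := by
  have h : Real.Gamma (γ + 2) = (γ + 1) * (γ * Real.Gamma γ) := by
    rw [show γ + 2 = (γ + 1) + 1 by ring, Real.Gamma_add_one (by positivity),
      Real.Gamma_add_one hγ.ne']
  have hg := (Real.Gamma_pos_of_pos hγ).ne'
  rw [poch, poch, h, show γ + ((k + 2 : ℕ) : ℝ) = γ + 2 + k by push_cast; ring]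
  field_simp

theorem prabhakarTerm_add_two {γ : ℝ} (α β t : ℝ) (hγ : 0 < γ) (k : ℕ) :
    (((k + 2 : ℕ) : ℝ) * (((k + 2 : ℕ) : ℝ) - 1)) * prabhakarTerm α β γ t (k + 2)
      = γ * (γ + 1) * t ^ 2 * prabhakarTerm α (2 * α + β) (γ + 2) t k := by
  have hfac : (k.factorial : ℝ) ≠ 0 := by exact_mod_cast k.factorial_ne_zero
  have hk1 : (k : ℝ) + 1 ≠ 0 := by positivity
  have hk2 : (k : ℝ) + 2 ≠ 0 := by positivity
  have hf : ((k + 2).factorial : ℝ) = (k + 2) * ((k + 1) * k.factorial) := by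
    rw [Nat.factorial_succ, Nat.factorial_succ]; push_cast; ring
  rw [prabhakarTerm, prabhakarTerm, poch_add_two hγ, hf,
    show α * ((k + 2 : ℕ) : ℝ) + β = α * k + (2 * α + β) by push_cast; ring]
  push_cast
  rw [show (k : ℝ) + 2 - 1 = k + 1 by ring, pow_add]
  field_simp

/-- Recurrence: `α² γ(γ+1) t² E_{α,2α+β+2}^{γ+2}(t)
      = E_{α,β}^γ(t) − (α+2β+1) E_{α,β+1}^γ(t) + (α+β+1)(β+1) E_{α,β+2}^γ(t)`. -/
theorem prabhakar_recurrence_two (α β γ t : ℝ) (hα : 0 < α) (hβ : 0 < β) (hγ : 0 < γ)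
    (ht : 0 < t) :
    α ^ 2 * γ * (γ + 1) * t ^ 2 * prabhakar α (2 * α + β + 2) (γ + 2) t
      = prabhakar α β γ t - (α + 2 * β + 1) * prabhakar α (β + 1) γ t
        + (α + β + 1) * (β + 1) * prabhakar α (β + 2) γ t := by
  have h0 := summable_prabhakarTerm hα hβ hγ ht
  have h1 := (summable_prabhakarTerm hα (by linarith : 0 < β + 1) hγ ht).mul_left (α + 2 * β + 1)
  have h2 := (summable_prabhakarTerm hα (by linarith : 0 < β + 2) hγ ht).mul_left
    ((α + β + 1) * (β + 1))
  have hsum := (h0.sub h1).add h2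
  change α ^ 2 * γ * (γ + 1) * t ^ 2 * (∑' k, prabhakarTerm α (2 * α + β + 2) (γ + 2) t k)
      = (∑' k, prabhakarTerm α β γ t k)
        - (α + 2 * β + 1) * (∑' k, prabhakarTerm α (β + 1) γ t k)
        + (α + β + 1) * (β + 1) * (∑' k, prabhakarTerm α (β + 2) γ t k)
  rw [← tsum_mul_left, ← tsum_mul_left, ← tsum_mul_left, ← h0.tsum_sub h1,
    ← (h0.sub h1).tsum_add h2]
  simp only [prabhakarTerm_combination t hα hβ] at hsum ⊢
  rw [← hsum.sum_add_tsum_nat_add 2]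
  simp only [Finset.sum_range_succ, Finset.sum_range_zero, Nat.cast_zero, Nat.cast_one, sub_self,
    zero_mul, mul_zero, add_zero, zero_add]
  refine tsum_congr fun k => ?_
  rw [mul_assoc (α ^ 2) _ (prabhakarTerm _ _ _ _ _), prabhakarTerm_add_two α (β + 2) t hγ k,
    ← add_assoc]
  ring
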